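/- arXiv:1910.13178 — 2 statements merged into one kernel-verified Lean document; each statement's English description precedes it below -/
import Mathlib

section
/- (Delivery Man Problem on a path.) Fix an integer n ≥ 1 and a root k ∈ {0,1,…,n}, and let e be the equiprobable distribution placing mass 1/(n+1) at each integer point 0,1,…,n of [0,n]. Then the two depth-first searches from k (unit speed from k to 0 then to n, and from k to n then to 0) are both optimal for e, the optimal expected search time is V(e,k) = n − (1/(n+1)) Σ_{i=0}^{n} |i − k|, and V(e,k) is minimized over k ∈ {0,…,n} exactly at the leaf nodes k = 0 and k = n, where it equals n/2. -/
open MeasureTheory Set Filter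
open scoped ENNReal

noncomputable section

/-- A search of the interval network `Q = [-l₂, l₁]` with root `0`:
a 1-Lipschitz function on `[0,∞)` taking values in `Q` and starting at the root. -/
def IsSearch (l₁ l₂ : ℝ) (S : ℝ → ℝ) : Prop :=
  S 0 = 0 ∧ (∀ t, 0 ≤ t → S t ∈ Icc (-l₂) l₁) ∧
    (∀ s t, 0 ≤ s → 0 ≤ t → |S s - S t| ≤ |s - t|)

/-- The search time `T(S,x) = inf {t ≥ 0 : S t = x}`, with value `∞` if `x` is never reached. -/
def searchTime (S : ℝ → ℝ) (x : ℝ) : ℝ≥0∞ :=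
  sInf (ENNReal.ofReal '' {t : ℝ | 0 ≤ t ∧ S t = x})

/-- The expected search time `T(S,h) = ∫_Q T(S,x) dh(x)`. -/
def expTime (S : ℝ → ℝ) (h : Measure ℝ) : ℝ≥0∞ :=
  ∫⁻ x, searchTime S x ∂h


/-- A search of the interval `[0, L]` starting from the root `t`:
a 1-Lipschitz function on `[0,∞)` with values in `[0,L]` and `S 0 = t`. -/
def IsSearchFrom (L t : ℝ) (S : ℝ → ℝ) : Prop :=
  S 0 = t ∧ (∀ s, 0 ≤ s → S s ∈ Icc 0 L) ∧
    (∀ s s' : ℝ, 0 ≤ s → 0 ≤ s' → |S s - S s'| ≤ |s - s'|)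

/-- The depth-first search from `t` that goes right first: unit speed from `t` to `L`,
then to `0`, then rests. -/
def SRight (L t : ℝ) (s : ℝ) : ℝ :=
  if s ≤ L - t then t + s else if s ≤ 2 * L - t then 2 * L - t - s else 0

/-- The depth-first search from `t` that goes left first: unit speed from `t` to `0`,
then to `L`, then rests. -/
def SLeft (L t : ℝ) (s : ℝ) : ℝ :=
  if s ≤ t then t - s else if s ≤ L + t then s - t else L

/-- The equiprobable distribution placing mass `1/(n+1)` at each integer point
`0, 1, …, n` of `[0, n]`. -/
def equiDist (n : ℕ) : Measure ℝ :=
  ((n : ℝ≥0∞) + 1)⁻¹ • ∑ i ∈ Finset.range (n + 1), Measure.dirac (i : ℝ)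

theorem isSearchFrom_SRight {L t : ℝ} (h0 : 0 ≤ t) (hL : t ≤ L) :
    IsSearchFrom L t (SRight L t) := by
  refine ⟨?_, ?_, ?_⟩
  · simp [SRight, hL]
  · intro s hs
    unfold SRight
    split_ifs <;> constructor <;> linarith
  · intro s s' hs hs'
    wlog h : s ≤ s' generalizing s s'
    · rw [abs_sub_comm, abs_sub_comm s]
      exact this s' s hs' hs (by linarith)
    rw [abs_sub_comm s, abs_of_nonneg (sub_nonneg.2 h), abs_le]
    unfold SRight
    split_ifs <;> constructor <;> linarith

theorem isSearchFrom_SLeft {L t : ℝ} (h0 : 0 ≤ t) (hL : t ≤ L) :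
    IsSearchFrom L t (SLeft L t) := by
  refine ⟨?_, ?_, ?_⟩
  · simp [SLeft, h0]
  · intro s hs
    unfold SLeft
    split_ifs <;> constructor <;> linarith
  · intro s s' hs hs'
    wlog h : s ≤ s' generalizing s s'
    · rw [abs_sub_comm, abs_sub_comm s]
      exact this s' s hs' hs (by linarith)
    rw [abs_sub_comm s, abs_of_nonneg (sub_nonneg.2 h), abs_le]
    unfold SLeft
    split_ifs <;> constructor <;> linarith

theorem expTime_equiDist (n : ℕ) (S : ℝ → ℝ) :
    expTime S (equiDist n) =
      ((n : ℝ≥0∞) + 1)⁻¹ * ∑ i ∈ Finset.range (n + 1), searchTime S i := by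
  simp [expTime, equiDist, lintegral_smul_measure]

theorem searchTime_le {S : ℝ → ℝ} {x t : ℝ} (ht : 0 ≤ t) (h : S t = x) :
    searchTime S x ≤ ENNReal.ofReal t :=
  sInf_le ⟨t, ⟨ht, h⟩, rfl⟩

/-- The first hitting time of a point that is reached at all is attained. -/
theorem exists_le_searchTime {L r x : ℝ} {S : ℝ → ℝ} (hS : IsSearchFrom L r S)
    (hx : searchTime S x ≠ ⊤) :
    ∃ t, 0 ≤ t ∧ S t = x ∧ ENNReal.ofReal t ≤ searchTime S x := by
  set A := {t : ℝ | 0 ≤ t ∧ S t = x} with hA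
  have hne : A.Nonempty := by
    by_contra h
    rw [not_nonempty_iff_eq_empty] at h
    exact hx (by simp [searchTime, ← hA, h])
  have hcont : ContinuousOn S (Ici 0) := by
    have : LipschitzOnWith 1 S (Ici 0) := LipschitzOnWith.of_dist_le_mul fun s hs t ht => by
      simpa [Real.dist_eq] using hS.2.2 s t hs ht
    exact this.continuousOn
  have hclosed : IsClosed A := hcont.preimage_isClosed_of_isClosed isClosed_Ici isClosed_singleton
  have hbdd : BddBelow A := ⟨0, fun t ht => ht.1⟩
  obtain ⟨h0, hmem⟩ := hclosed.csInf_mem hne hbdd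
  refine ⟨sInf A, h0, hmem, le_sInf ?_⟩
  rintro _ ⟨t, ht, rfl⟩
  exact ENNReal.ofReal_le_ofReal (csInf_le hbdd ht)

theorem sum_range_split {M : Type*} [AddCommMonoid M] (f : ℕ → M) (k m : ℕ) :
    ∑ i ∈ Finset.range (k + m + 1), f i =
      ∑ a ∈ Finset.range k, f (k - 1 - a) + f k + ∑ b ∈ Finset.range m, f (k + 1 + b) := by
  rw [Finset.sum_range_reflect, show k + m + 1 = k + 1 + m by ring, Finset.sum_range_add,
    Finset.sum_range_succ]

theorem sum_range_add_one (p : ℕ) :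
    ∑ a ∈ Finset.range p, ((a : ℝ) + 1) = p * (p + 1) / 2 := by
  induction p with
  | zero => simp
  | succ p ih => rw [Finset.sum_range_succ, ih]; push_cast; ring

/-- The point visited last among the two extreme points has to be preceded by a traversal of
the whole other side. -/
theorem le_sum_add_sum_of_le_abs_sub (p q : ℕ) (u v : ℕ → ℝ)
    (hu : ∀ a < p, (a : ℝ) + 1 ≤ u a) (hv : ∀ b < q, (b : ℝ) + 1 ≤ v b)
    (huv : ∀ a < p, ∀ b < q, (a : ℝ) + b + 2 ≤ |u a - v b|) :
    (p * (p + 1) / 2 + q * (q + 1) / 2 + 2 * p * q : ℝ) ≤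
      ∑ a ∈ Finset.range p, u a + ∑ b ∈ Finset.range q, v b := by
  induction p generalizing q with
  | zero =>
    have := Finset.sum_le_sum fun b hb => hv b (Finset.mem_range.1 hb)
    rw [sum_range_add_one] at this
    simpa using this
  | succ p ihp =>
    induction q with
    | zero =>
      have := Finset.sum_le_sum fun a ha => hu a (Finset.mem_range.1 ha)
      rw [sum_range_add_one] at this
      simpa using this
    | succ q ihq =>
      have hup := hu p p.lt_succ_self
      have hvq := hv q q.lt_succ_self
      have h := huv p p.lt_succ_self q q.lt_succ_self
      rcases le_abs'.1 h with h | h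
      · have := ihq (fun b hb => hv b (by omega)) (fun a ha b hb => huv a ha b (by omega))
        rw [Finset.sum_range_succ v]
        push_cast at this ⊢
        linarith
      · have := ihp (q + 1) (fun a ha => hu a (by omega)) hv
          (fun a ha b hb => huv a (by omega) b hb)
        rw [Finset.sum_range_succ u]
        push_cast at this ⊢
        linarith

theorem sum_abs_sub (k m : ℕ) :
    ∑ i ∈ Finset.range (k + m + 1), |(i : ℝ) - k| =
      (k * (k + 1) / 2 + m * (m + 1) / 2 : ℝ) := by
  rw [sum_range_split, ← sum_range_add_one k, ← sum_range_add_one m, sub_self, abs_zero, add_zero]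
  congr 1
  · refine Finset.sum_congr rfl fun a ha => ?_
    have := Finset.mem_range.1 ha
    obtain ⟨d, rfl⟩ : ∃ d, k = d + a + 1 := ⟨k - a - 1, by omega⟩
    rw [show d + a + 1 - 1 - a = d by omega, abs_of_nonpos (by push_cast; linarith)]
    push_cast
    ring
  · refine Finset.sum_congr rfl fun b _ => ?_
    rw [abs_of_nonneg (by push_cast; linarith)]
    push_cast
    ring

/-- The total time at which a depth-first search from `k` visits the integer points of
`[0, k + m]`. -/
def dfsTotalTime (k m : ℕ) : ℝ :=
  k * (k + 1) / 2 + m * (m + 1) / 2 + 2 * k * m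

theorem ofReal_dfsTotalTime_le {k m : ℕ} {S : ℝ → ℝ}
    (hS : IsSearchFrom ((k + m : ℕ) : ℝ) k S) :
    ENNReal.ofReal (dfsTotalTime k m) ≤
      ∑ i ∈ Finset.range (k + m + 1), searchTime S i := by
  by_cases hfin : ∀ i ∈ Finset.range (k + m + 1), searchTime S i ≠ ⊤
  swap
  · have : ∑ i ∈ Finset.range (k + m + 1), searchTime S i = ⊤ := by
      rw [ENNReal.sum_eq_top]
      push Not at hfin
      exact hfin
    rw [this]
    exact le_top
  choose! t ht0 htS htle using fun i hi => exists_le_searchTime hS (hfin i hi)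
  refine le_trans ?_ (Finset.sum_le_sum htle)
  rw [← ENNReal.ofReal_sum_of_nonneg ht0]
  refine ENNReal.ofReal_le_ofReal ?_
  have hmem : ∀ i, i < k + m + 1 → i ∈ Finset.range (k + m + 1) := fun i => Finset.mem_range.2
  have hlip : ∀ i < k + m + 1, ∀ j < k + m + 1, (j : ℝ) - i ≤ |t i - t j| := fun i hi j hj => by
    have h := hS.2.2 _ _ (ht0 i (hmem i hi)) (ht0 j (hmem j hj))
    rw [htS i (hmem i hi), htS j (hmem j hj)] at h
    linarith [neg_abs_le ((i : ℝ) - j)]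
  have hroot : ∀ i < k + m + 1, |(i : ℝ) - k| ≤ t i := fun i hi => by
    have h := hS.2.2 _ _ (ht0 i (hmem i hi)) le_rfl
    rwa [htS i (hmem i hi), hS.1, sub_zero, abs_of_nonneg (ht0 i (hmem i hi))] at h
  have hleft : ∀ a < k, ((k - 1 - a : ℕ) : ℝ) = k - 1 - a := fun a ha => by
    rw [Nat.cast_sub (by omega), Nat.cast_sub (by omega), Nat.cast_one]
  have hmain := le_sum_add_sum_of_le_abs_sub k m (fun a => t (k - 1 - a)) (fun b => t (k + 1 + b))
    (fun a ha => by
      have h := hroot (k - 1 - a) (by omega)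
      rw [hleft a ha] at h
      linarith [neg_abs_le ((k : ℝ) - 1 - a - k)])
    (fun b hb => by
      have h := hroot (k + 1 + b) (by omega)
      push_cast at h
      linarith [le_abs_self ((k : ℝ) + 1 + b - k)])
    (fun a ha b hb => by
      have h := hlip (k - 1 - a) (by omega) (k + 1 + b) (by omega)
      rw [hleft a ha] at h
      push_cast at h
      linarith)
  rw [sum_range_split]
  have := ht0 k (hmem k (by omega))
  unfold dfsTotalTime
  linarith

theorem sum_searchTime_SRight_le (k m : ℕ) :
    ∑ i ∈ Finset.range (k + m + 1), searchTime (SRight ((k + m : ℕ) : ℝ) k) i ≤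
      ENNReal.ofReal (dfsTotalTime k m) := by
  have key : ∀ i ∈ Finset.range (k + m + 1),
      searchTime (SRight ((k + m : ℕ) : ℝ) k) i ≤
        ENNReal.ofReal (|(i : ℝ) - k| + if i < k then 2 * (m : ℝ) else 0) := fun i hi => by
    have hi' : (i : ℝ) ≤ k + m := by exact_mod_cast Nat.lt_succ_iff.1 (Finset.mem_range.1 hi)
    have hi0 : (0 : ℝ) ≤ i := i.cast_nonneg
    refine searchTime_le (by positivity) ?_
    unfold SRight
    push_cast
    rcases lt_or_ge i k with h | h
    · have h' : (i : ℝ) < k := by exact_mod_cast h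
      rw [if_pos h, abs_of_nonpos (by linarith), if_neg (by linarith), if_pos (by linarith)]
      ring
    · have h' : (k : ℝ) ≤ i := by exact_mod_cast h
      rw [if_neg h.not_gt, abs_of_nonneg (by linarith), if_pos (by linarith)]
      ring
  refine (Finset.sum_le_sum key).trans_eq ?_
  have hfilter : (Finset.range (k + m + 1)).filter (· < k) = Finset.range k := by
    ext i
    simp only [Finset.mem_filter, Finset.mem_range]
    omega
  rw [← ENNReal.ofReal_sum_of_nonneg (fun i _ => by positivity), Finset.sum_add_distrib,
    sum_abs_sub, ← Finset.sum_filter, hfilter, Finset.sum_const, Finset.card_range,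
    nsmul_eq_mul, dfsTotalTime]
  ring_nf

theorem sum_searchTime_SLeft_le (k m : ℕ) :
    ∑ i ∈ Finset.range (k + m + 1), searchTime (SLeft ((k + m : ℕ) : ℝ) k) i ≤
      ENNReal.ofReal (dfsTotalTime k m) := by
  have key : ∀ i ∈ Finset.range (k + m + 1),
      searchTime (SLeft ((k + m : ℕ) : ℝ) k) i ≤
        ENNReal.ofReal (|(i : ℝ) - k| + if k < i then 2 * (k : ℝ) else 0) := fun i hi => by
    have hi' : (i : ℝ) ≤ k + m := by exact_mod_cast Nat.lt_succ_iff.1 (Finset.mem_range.1 hi)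
    have hi0 : (0 : ℝ) ≤ i := i.cast_nonneg
    have hk0 : (0 : ℝ) ≤ k := k.cast_nonneg
    refine searchTime_le (by positivity) ?_
    unfold SLeft
    push_cast
    rcases lt_or_ge k i with h | h
    · have h' : (k : ℝ) < i := by exact_mod_cast h
      rw [if_pos h, abs_of_nonneg (by linarith), if_neg (by linarith), if_pos (by linarith)]
      ring
    · have h' : (i : ℝ) ≤ k := by exact_mod_cast h
      rw [if_neg h.not_gt, abs_of_nonpos (by linarith), if_pos (by linarith)]
      ring
  refine (Finset.sum_le_sum key).trans_eq ?_
  have hfilter : (Finset.range (k + m + 1)).filter (k < ·) = Finset.Ico (k + 1) (k + 1 + m) := by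
    ext i
    simp only [Finset.mem_filter, Finset.mem_range, Finset.mem_Ico]
    omega
  rw [← ENNReal.ofReal_sum_of_nonneg (fun i _ => by positivity), Finset.sum_add_distrib,
    sum_abs_sub, ← Finset.sum_filter, hfilter, Finset.sum_const, Nat.card_Ico,
    Nat.add_sub_cancel_left, nsmul_eq_mul, dfsTotalTime]
  ring_nf

theorem inv_mul_ofReal_dfsTotalTime (k m : ℕ) :
    (((k + m : ℕ) : ℝ≥0∞) + 1)⁻¹ * ENNReal.ofReal (dfsTotalTime k m) =
      ENNReal.ofReal (dfsTotalTime k m / (((k + m : ℕ) : ℝ) + 1)) := by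
  rw [ENNReal.ofReal_div_of_pos (by positivity), ENNReal.ofReal_add (by positivity) zero_le_one,
    ENNReal.ofReal_natCast, ENNReal.ofReal_one, div_eq_mul_inv, mul_comm]

theorem dfsTotalTime_div_eq (k m : ℕ) :
    dfsTotalTime k m / (((k + m : ℕ) : ℝ) + 1) =
      ((k + m : ℕ) : ℝ) - (1 / (((k + m : ℕ) : ℝ) + 1)) *
        ∑ i ∈ Finset.range (k + m + 1), |(i : ℝ) - k| := by
  have : ((k + m : ℕ) : ℝ) + 1 ≠ 0 := by positivity
  rw [sum_abs_sub, dfsTotalTime]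
  field_simp
  push_cast
  ring

theorem dfsTotalTime_div_eq_half_add (k m : ℕ) :
    dfsTotalTime k m / (((k + m : ℕ) : ℝ) + 1) =
      ((k + m : ℕ) : ℝ) / 2 + k * m / (((k + m : ℕ) : ℝ) + 1) := by
  have : ((k + m : ℕ) : ℝ) + 1 ≠ 0 := by positivity
  rw [dfsTotalTime]
  field_simp
  push_cast
  ring

/-- The Delivery Man Problem on a path with unit-length arcs: from any integer root `k`,
both depth-first searches are optimal for the equiprobable distribution `e`, the value is
`V(e,k) = n - (1/(n+1)) Σᵢ |i - k|`, and `V(e,k)` is minimized exactly at the leaf nodes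
`k = 0` and `k = n`, where it equals `n/2`. -/
theorem delivery_man_on_path (n : ℕ) (hn : 1 ≤ n) :
    ∀ k : ℕ, k ≤ n →
      IsSearchFrom (n : ℝ) (k : ℝ) (SRight (n : ℝ) (k : ℝ)) ∧
      IsSearchFrom (n : ℝ) (k : ℝ) (SLeft (n : ℝ) (k : ℝ)) ∧
      (∀ S' : ℝ → ℝ, IsSearchFrom (n : ℝ) (k : ℝ) S' →
        expTime (SRight (n : ℝ) (k : ℝ)) (equiDist n) ≤ expTime S' (equiDist n)) ∧
      (∀ S' : ℝ → ℝ, IsSearchFrom (n : ℝ) (k : ℝ) S' →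
        expTime (SLeft (n : ℝ) (k : ℝ)) (equiDist n) ≤ expTime S' (equiDist n)) ∧
      (⨅ S : {S : ℝ → ℝ // IsSearchFrom (n : ℝ) (k : ℝ) S}, expTime S.1 (equiDist n))
        = ENNReal.ofReal ((n : ℝ)
            - (1 / ((n : ℝ) + 1)) * ∑ i ∈ Finset.range (n + 1), |(i : ℝ) - (k : ℝ)|) ∧
      ENNReal.ofReal ((n : ℝ) / 2)
        ≤ (⨅ S : {S : ℝ → ℝ // IsSearchFrom (n : ℝ) (k : ℝ) S},
            expTime S.1 (equiDist n)) ∧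
      ((⨅ S : {S : ℝ → ℝ // IsSearchFrom (n : ℝ) (k : ℝ) S}, expTime S.1 (equiDist n))
          = ENNReal.ofReal ((n : ℝ) / 2) ↔ k = 0 ∨ k = n) := by
  intro k hk
  obtain ⟨m, rfl⟩ := Nat.exists_eq_add_of_le hk
  have hk0 : (0 : ℝ) ≤ k := k.cast_nonneg
  have hkn : (k : ℝ) ≤ ((k + m : ℕ) : ℝ) := by exact_mod_cast hk
  have hright := isSearchFrom_SRight hk0 hkn
  have hleft := isSearchFrom_SLeft hk0 hkn
  set c := dfsTotalTime k m / (((k + m : ℕ) : ℝ) + 1) with hc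
  have lower : ∀ S, IsSearchFrom ((k + m : ℕ) : ℝ) k S →
      ENNReal.ofReal c ≤ expTime S (equiDist (k + m)) := fun S hS => by
    rw [expTime_equiDist, ← inv_mul_ofReal_dfsTotalTime]
    gcongr
    exact ofReal_dfsTotalTime_le hS
  have upper_right : expTime (SRight ((k + m : ℕ) : ℝ) k) (equiDist (k + m)) ≤
      ENNReal.ofReal c := by
    rw [expTime_equiDist, ← inv_mul_ofReal_dfsTotalTime]
    gcongr
    exact sum_searchTime_SRight_le k m
  have upper_left : expTime (SLeft ((k + m : ℕ) : ℝ) k) (equiDist (k + m)) ≤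
      ENNReal.ofReal c := by
    rw [expTime_equiDist, ← inv_mul_ofReal_dfsTotalTime]
    gcongr
    exact sum_searchTime_SLeft_le k m
  have value : (⨅ S : {S : ℝ → ℝ // IsSearchFrom ((k + m : ℕ) : ℝ) k S},
      expTime S.1 (equiDist (k + m))) = ENNReal.ofReal c :=
    le_antisymm ((iInf_le _ ⟨_, hright⟩).trans upper_right) (le_iInf fun S => lower S.1 S.2)
  have hhalf : c = ((k + m : ℕ) : ℝ) / 2 + k * m / (((k + m : ℕ) : ℝ) + 1) :=
    dfsTotalTime_div_eq_half_add k m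
  have hextra : (0 : ℝ) ≤ k * m / (((k + m : ℕ) : ℝ) + 1) := by positivity
  refine ⟨hright, hleft, fun S hS => upper_right.trans (lower S hS),
    fun S hS => upper_left.trans (lower S hS), ?_, ?_, ?_⟩
  · rw [value, hc, dfsTotalTime_div_eq]
  · rw [value]
    exact ENNReal.ofReal_le_ofReal (by linarith)
  · rw [value, ENNReal.ofReal_eq_ofReal_iff (by rw [hhalf]; positivity) (by positivity), hhalf,
      add_eq_left, div_eq_zero_iff, or_iff_left (by positivity), mul_eq_zero, Nat.cast_eq_zero,
      Nat.cast_eq_zero]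
    omega

end
end

section
/- Assume the hiding distribution h on Q satisfies h({0}) = 0. For 0 < y < λ₂, let Ŝ(y) be the single-turn search that moves at unit speed from 0 to −y, then to λ₁, then to −λ₂ (and is constant thereafter). Then T(Ŝ(y),h) < T(S⁺,h) if and only if F₂(y) > y/(λ₁ + y). -/
open MeasureTheory Set Filter
open scoped ENNReal

noncomputable section

/-- The depth-first search `S⁺`: unit speed from `0` to `l₁`, then to `-l₂`, then rests. -/
def Splus (l₁ l₂ : ℝ) (t : ℝ) : ℝ :=
  if t ≤ l₁ then t else if t ≤ 2 * l₁ + l₂ then 2 * l₁ - t else -l₂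

/-- The depth-first search `S⁻`: unit speed from `0` to `-l₂`, then to `l₁`, then rests. -/
def Sminus (l₁ l₂ : ℝ) (t : ℝ) : ℝ :=
  if t ≤ l₂ then -t else if t ≤ 2 * l₂ + l₁ then t - 2 * l₂ else l₁

/-- A hiding distribution is balanced if the two branches at the root have equal search
density: `λ₂ · h((0,λ₁]) = λ₁ · h([-λ₂,0))`. -/
def BalancedDist (l₁ l₂ : ℝ) (h : Measure ℝ) : Prop :=
  l₂ * (h (Ioc 0 l₁)).toReal = l₁ * (h (Ico (-l₂) 0)).toReal

/-- `F₁(x) = h((0,x])`: the cdf of the hiding distribution on the right arc. -/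
def cdfRight (h : Measure ℝ) (x : ℝ) : ℝ := (h (Ioc 0 x)).toReal

/-- `F₂(y) = h([-y,0))`: the cdf of the hiding distribution on the left arc. -/
def cdfLeft (h : Measure ℝ) (y : ℝ) : ℝ := (h (Ico (-y) 0)).toReal

/-- A hiding distribution on the two-arc star `Q = [-l₂, l₁]` is forward biased if
`F₁(x) ≤ (x + (h₁μ - λ₁)⁺)/(x + μ - λ₁)` for all `0 ≤ x ≤ λ₁` and
`F₂(y) ≤ (y + (h₂μ - λ₂)⁺)/(y + μ - λ₂)` for all `0 ≤ y ≤ λ₂`. -/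
def ForwardBiased (l₁ l₂ : ℝ) (h : Measure ℝ) : Prop :=
  (∀ x : ℝ, 0 ≤ x → x ≤ l₁ →
    cdfRight h x ≤ (x + max (cdfRight h l₁ * (l₁ + l₂) - l₁) 0) / (x + (l₁ + l₂) - l₁)) ∧
  (∀ y : ℝ, 0 ≤ y → y ≤ l₂ →
    cdfLeft h y ≤ (y + max (cdfLeft h l₂ * (l₁ + l₂) - l₂) 0) / (y + (l₁ + l₂) - l₂))

/-- Strictly forward biased: the forward-biased inequalities hold strictly at every
interior point of each arc. -/
def StrictlyForwardBiased (l₁ l₂ : ℝ) (h : Measure ℝ) : Prop :=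
  ForwardBiased l₁ l₂ h ∧
  (∀ x : ℝ, 0 < x → x < l₁ →
    cdfRight h x < (x + max (cdfRight h l₁ * (l₁ + l₂) - l₁) 0) / (x + (l₁ + l₂) - l₁)) ∧
  (∀ y : ℝ, 0 < y → y < l₂ →
    cdfLeft h y < (y + max (cdfLeft h l₂ * (l₁ + l₂) - l₂) 0) / (y + (l₁ + l₂) - l₂))

/-- The single-turn search `Ŝ(y)`: unit speed from `0` to `-y`, then to `l₁`, then to
`-l₂`, then rests. -/
def Shat (l₁ l₂ y : ℝ) (t : ℝ) : ℝ :=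
  if t ≤ y then -t
  else if t ≤ 2 * y + l₁ then t - 2 * y
  else if t ≤ 2 * y + 2 * l₁ + l₂ then 2 * y + 2 * l₁ - t
  else -l₂

/-- The search time of `x` is `t` as soon as `t` is the first time at which `x` is visited. -/
lemma searchTime_eq_ofReal {S : ℝ → ℝ} {x t : ℝ} (ht : 0 ≤ t) (hS : S t = x)
    (hmin : ∀ s, 0 ≤ s → S s = x → t ≤ s) : searchTime S x = ENNReal.ofReal t := by
  refine le_antisymm (sInf_le ⟨t, ⟨ht, hS⟩, rfl⟩) (le_sInf ?_)
  rintro _ ⟨s, ⟨hs, hsx⟩, rfl⟩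
  exact ENNReal.ofReal_le_ofReal (hmin s hs hsx)

lemma searchTime_Splus_of_pos {l₁ l₂ x : ℝ} (hl₂ : 0 < l₂) (hx : 0 < x) (hx₁ : x ≤ l₁) :
    searchTime (Splus l₁ l₂) x = ENNReal.ofReal x := by
  apply searchTime_eq_ofReal hx.le
  · simp only [Splus]; split_ifs; rfl
  · intro s hs h
    simp only [Splus] at h
    split_ifs at h <;> linarith

lemma searchTime_Splus_of_neg {l₁ l₂ x : ℝ} (hl₁ : 0 < l₁) (hx : x < 0) (hx₂ : -l₂ ≤ x) :
    searchTime (Splus l₁ l₂) x = ENNReal.ofReal (2 * l₁ - x) := by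
  apply searchTime_eq_ofReal (by linarith)
  · simp only [Splus]; split_ifs <;> linarith
  · intro s hs h
    simp only [Splus] at h
    split_ifs at h <;> linarith

lemma searchTime_Shat_of_pos {l₁ l₂ x y : ℝ} (hl₂ : 0 < l₂) (hy : 0 < y) (hx : 0 < x)
    (hx₁ : x ≤ l₁) : searchTime (Shat l₁ l₂ y) x = ENNReal.ofReal (x + 2 * y) := by
  apply searchTime_eq_ofReal (by linarith)
  · simp only [Shat]; split_ifs <;> linarith
  · intro s hs h
    simp only [Shat] at h
    split_ifs at h <;> linarith

lemma searchTime_Shat_of_near {l₁ l₂ x y : ℝ} (hl₁ : 0 < l₁) (hy : y < l₂) (hx : x < 0)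
    (hxy : -y ≤ x) : searchTime (Shat l₁ l₂ y) x = ENNReal.ofReal (-x) := by
  apply searchTime_eq_ofReal (by linarith)
  · simp only [Shat]; split_ifs <;> linarith
  · intro s hs h
    simp only [Shat] at h
    split_ifs at h <;> linarith

lemma searchTime_Shat_of_far {l₁ l₂ x y : ℝ} (hl₁ : 0 < l₁) (hy : 0 < y) (hxy : x < -y)
    (hx₂ : -l₂ ≤ x) : searchTime (Shat l₁ l₂ y) x = ENNReal.ofReal (2 * y + 2 * l₁ - x) := by
  apply searchTime_eq_ofReal (by linarith)
  · simp only [Shat]; split_ifs <;> linarith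
  · intro s hs h
    simp only [Shat] at h
    split_ifs at h <;> linarith

/-- Away from the root, `Ŝ(y)` gains `2 l₁` over `S⁺` on `[-y, 0)` and loses `2 y` elsewhere. -/
lemma searchTime_Shat_add_indicator {l₁ l₂ x y : ℝ} (hl₁ : 0 < l₁) (hl₂ : 0 < l₂) (hy : 0 < y)
    (hyl₂ : y < l₂) (hx : x ∈ Icc (-l₂) l₁) (hx0 : x ≠ 0) :
    searchTime (Shat l₁ l₂ y) x +
        (Ico (-y) 0).indicator (fun _ => ENNReal.ofReal (2 * (l₁ + y))) x =
      searchTime (Splus l₁ l₂) x + ENNReal.ofReal (2 * y) := by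
  obtain ⟨hx₂, hx₁⟩ := hx
  rcases lt_or_gt_of_ne hx0 with hneg | hpos
  · rw [searchTime_Splus_of_neg hl₁ hneg hx₂,
      ← ENNReal.ofReal_add (by linarith) (by linarith)]
    by_cases hxy : -y ≤ x
    · rw [searchTime_Shat_of_near hl₁ hyl₂ hneg hxy, indicator_of_mem (mem_Ico.mpr ⟨hxy, hneg⟩),
        ← ENNReal.ofReal_add (by linarith) (by linarith)]
      congr 1; ring
    · rw [searchTime_Shat_of_far hl₁ hy (not_le.mp hxy) hx₂,
        indicator_of_notMem (fun h => hxy h.1), add_zero]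
      congr 1; ring
  · rw [searchTime_Splus_of_pos hl₂ hpos hx₁, searchTime_Shat_of_pos hl₂ hy hpos hx₁,
      indicator_of_notMem (fun h => hpos.not_gt h.2), add_zero,
      ENNReal.ofReal_add hpos.le (by linarith)]

lemma searchTime_Splus_le {l₁ l₂ x : ℝ} (hl₁ : 0 < l₁) (hl₂ : 0 < l₂)
    (hx : x ∈ Icc (-l₂) l₁) (hx0 : x ≠ 0) :
    searchTime (Splus l₁ l₂) x ≤ ENNReal.ofReal (2 * l₁ + l₂) := by
  obtain ⟨hx₂, hx₁⟩ := hx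
  rcases lt_or_gt_of_ne hx0 with hneg | hpos
  · rw [searchTime_Splus_of_neg hl₁ hneg hx₂]
    exact ENNReal.ofReal_le_ofReal (by linarith)
  · rw [searchTime_Splus_of_pos hl₂ hpos hx₁]
    exact ENNReal.ofReal_le_ofReal (by linarith)

/-- `T(Ŝ(y),h) < T(S⁺,h)` if and only if `F₂(y) > y/(λ₁ + y)`. -/
theorem Shat_beats_Splus_iff (l₁ l₂ : ℝ) (hl₁ : 0 < l₁) (hl₂ : 0 < l₂)
    (h : Measure ℝ) [IsProbabilityMeasure h] (hsupp : h (Icc (-l₂) l₁) = 1)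
    (hroot : h {0} = 0) (y : ℝ) (hy0 : 0 < y) (hy1 : y < l₂) :
    expTime (Shat l₁ l₂ y) h < expTime (Splus l₁ l₂) h ↔
      y / (l₁ + y) < cdfLeft h y := by
  have hQ : ∀ᵐ x ∂h, x ∈ Icc (-l₂) l₁ ∧ x ≠ 0 :=
    inter_mem ((mem_ae_iff_prob_eq_one measurableSet_Icc).mpr hsupp) (compl_mem_ae_iff.mpr hroot)
  have hsum : expTime (Shat l₁ l₂ y) h + ENNReal.ofReal (2 * (l₁ + y)) * h (Ico (-y) 0) =
      expTime (Splus l₁ l₂) h + ENNReal.ofReal (2 * y) := by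
    have hconst : ∫⁻ _, ENNReal.ofReal (2 * y) ∂h = ENNReal.ofReal (2 * y) := by simp
    rw [expTime, expTime, ← lintegral_indicator_const measurableSet_Ico, ← hconst,
      ← lintegral_add_right _ (measurable_const.indicator measurableSet_Ico),
      ← lintegral_add_right _ measurable_const]
    refine lintegral_congr_ae (hQ.mono fun x hx => ?_)
    exact searchTime_Shat_add_indicator hl₁ hl₂ hy0 hy1 hx.1 hx.2
  have hplus : expTime (Splus l₁ l₂) h ≠ ∞ := by
    refine ne_top_of_le_ne_top ENNReal.ofReal_ne_top (b := ENNReal.ofReal (2 * l₁ + l₂)) ?_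
    calc expTime (Splus l₁ l₂) h ≤ ∫⁻ _, ENNReal.ofReal (2 * l₁ + l₂) ∂h :=
          lintegral_mono_ae (hQ.mono fun x hx => searchTime_Splus_le hl₁ hl₂ hx.1 hx.2)
      _ = ENNReal.ofReal (2 * l₁ + l₂) := by simp
  have hhat : expTime (Shat l₁ l₂ y) h ≠ ∞ :=
    ne_top_of_le_ne_top (ENNReal.add_ne_top.mpr ⟨hplus, ENNReal.ofReal_ne_top⟩)
      (le_self_add.trans hsum.le)
  have hreal := congrArg ENNReal.toReal hsum
  rw [ENNReal.toReal_add hhat (ENNReal.mul_ne_top ENNReal.ofReal_ne_top (measure_ne_top _ _)),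
    ENNReal.toReal_add hplus ENNReal.ofReal_ne_top, ENNReal.toReal_mul,
    ENNReal.toReal_ofReal (by linarith), ENNReal.toReal_ofReal (by linarith)] at hreal
  rw [← ENNReal.toReal_lt_toReal hhat hplus, div_lt_iff₀ (by linarith), cdfLeft]
  constructor <;> intro _ <;> linarith
end
end
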